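/- arXiv:1610.02824 — 3 statements merged into one kernel-verified Lean document; each statement's English description precedes it below -/
import Mathlib

section
/- Let (G,I,O,λ) be an open graph, let < be a strict partial order on Oᶜ and p : Oᶜ → 2^{Iᶜ} a map. Then (p,<) satisfies the original Pauli flow conditions (P1)–(P9) if and only if for every u ∈ Oᶜ the following three simplified conditions hold: (cX) X ∈ λ_u implies u ∈ Odd(p(u)) and u ∉ Odd(p(v)) for every v ∈ Oᶜ∖{u} with ¬(v<u); (cY) Y ∈ λ_u implies u ∈ codd(p(u)) and u ∉ codd(p(v)) for every v ∈ Oᶜ∖{u} with ¬(v<u); (cZ) Z ∈ λ_u implies u ∈ p(u) and u ∉ p(v) for every v ∈ Oᶜ∖{u} with ¬(v<u). In particular, (G,I,O,λ) has a Pauli flow in the original sense if and only if it has one in the simplified sense. -/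
inductive Pauli : Type
  | X
  | Y
  | Z
  deriving DecidableEq

open Finset
open scoped symmDiff

variable {V : Type*} [Fintype V] [DecidableEq V]

instance : Std.Commutative (α := Finset V) (· ∆ ·) := ⟨symmDiff_comm⟩
instance : Std.Associative (α := Finset V) (· ∆ ·) := ⟨symmDiff_assoc⟩

/-- Odd neighbourhood of `A`: the symmetric difference `Δ_{v ∈ A} N(v)` of the open
neighbourhoods of the elements of `A`. -/
def SimpleGraph.oddNbhd (G : SimpleGraph V) [DecidableRel G.Adj] (A : Finset V) : Finset V :=
  A.fold (· ∆ ·) ∅ fun v => G.neighborFinset v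

/-- Closed odd neighbourhood of `A`: the symmetric difference `Δ_{v ∈ A} N[v]` of the closed
neighbourhoods `N[v] = N(v) ∪ {v}` of the elements of `A`. -/
def SimpleGraph.coddNbhd (G : SimpleGraph V) [DecidableRel G.Adj] (A : Finset V) : Finset V :=
  A.fold (· ∆ ·) ∅ fun v => insert v (G.neighborFinset v)

theorem SimpleGraph.coddNbhd_eq_symmDiff (G : SimpleGraph V) [DecidableRel G.Adj]
    (A : Finset V) : G.coddNbhd A = A ∆ G.oddNbhd A := by
  induction A using Finset.induction_on with
  | empty => simp [SimpleGraph.coddNbhd, SimpleGraph.oddNbhd]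
  | insert a s ha ih =>
    have hc : G.coddNbhd (insert a s) = insert a (G.neighborFinset a) ∆ G.coddNbhd s := by
      simp only [SimpleGraph.coddNbhd, Finset.fold_insert ha]
    have ho : G.oddNbhd (insert a s) = G.neighborFinset a ∆ G.oddNbhd s := by
      simp only [SimpleGraph.oddNbhd, Finset.fold_insert ha]
    have hloop : a ∉ G.neighborFinset a := by simp
    rw [hc, ho, ih]
    ext x
    simp only [Finset.mem_symmDiff, Finset.mem_insert]
    grind

theorem SimpleGraph.mem_coddNbhd (G : SimpleGraph V) [DecidableRel G.Adj] (A : Finset V)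
    (v : V) : v ∈ G.coddNbhd A ↔ ¬(v ∈ A ↔ v ∈ G.oddNbhd A) := by
  rw [G.coddNbhd_eq_symmDiff, Finset.mem_symmDiff]
  tauto

/-- Given an open graph `(G,I,O,λ)`, a strict partial order `<` on `Oᶜ` and `p : Oᶜ → 2^{Iᶜ}`,
the original Pauli-flow conditions (P1)–(P9) hold iff for every `u ∈ Oᶜ` the simplified
conditions (cX), (cY), (cZ) hold. -/
theorem pauliFlow_conditions_iff_simplified (G : SimpleGraph V) [DecidableRel G.Adj]
    (I O : Finset V) (lam : V → Finset Pauli)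
    (hlam : ∀ u, u ∉ O →
      lam u = {Pauli.X} ∨ lam u = {Pauli.Y} ∨ lam u = {Pauli.Z} ∨
      lam u = {Pauli.X, Pauli.Y} ∨ lam u = {Pauli.X, Pauli.Z} ∨ lam u = {Pauli.Y, Pauli.Z})
    (p : V → Finset V) (hp : ∀ u, u ∉ O → Disjoint (p u) I)
    (lt : V → V → Prop) (hirr : IsIrrefl V lt) (htrans : IsTrans V lt) :
    -- original conditions (P1)–(P9), where `v ≤ u` means `¬ (u < v)`
    ((∀ u, u ∉ O → ∀ v, v ∉ O →
        -- (P1)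
        (v ∈ p u → u ≠ v → lam v ≠ {Pauli.X} → lam v ≠ {Pauli.Y} → lt u v) ∧
        -- (P2)
        (¬ lt u v → u ≠ v → lam v ≠ {Pauli.Y} → lam v ≠ {Pauli.Z} → v ∉ G.oddNbhd (p u)) ∧
        -- (P3)
        (¬ lt u v → u ≠ v → lam v = {Pauli.Y} → (v ∈ p u ↔ v ∈ G.oddNbhd (p u)))) ∧
      (∀ u, u ∉ O →
        -- (P4)
        (lam u = {Pauli.X, Pauli.Y} → u ∉ p u ∧ u ∈ G.oddNbhd (p u)) ∧
        -- (P5)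
        (lam u = {Pauli.X, Pauli.Z} → u ∈ p u ∧ u ∈ G.oddNbhd (p u)) ∧
        -- (P6)
        (lam u = {Pauli.Y, Pauli.Z} → u ∈ p u ∧ u ∉ G.oddNbhd (p u)) ∧
        -- (P7)
        (lam u = {Pauli.X} → u ∈ G.oddNbhd (p u)) ∧
        -- (P8)
        (lam u = {Pauli.Z} → u ∈ p u) ∧
        -- (P9)
        (lam u = {Pauli.Y} →
          ((u ∉ p u ∧ u ∈ G.oddNbhd (p u)) ∨ (u ∈ p u ∧ u ∉ G.oddNbhd (p u)))))) ↔
    -- simplified conditions (cX), (cY), (cZ)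
    (∀ u, u ∉ O →
        (Pauli.X ∈ lam u → u ∈ G.oddNbhd (p u) ∧
          ∀ v, v ∉ O → v ≠ u → ¬ lt v u → u ∉ G.oddNbhd (p v)) ∧
        (Pauli.Y ∈ lam u → u ∈ G.coddNbhd (p u) ∧
          ∀ v, v ∉ O → v ≠ u → ¬ lt v u → u ∉ G.coddNbhd (p v)) ∧
        (Pauli.Z ∈ lam u → u ∈ p u ∧
          ∀ v, v ∉ O → v ≠ u → ¬ lt v u → u ∉ p v)) := by
  simp only [G.mem_coddNbhd]
  constructor
  · rintro ⟨h, h'⟩ u hu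
    have hcorr := fun v hv => h v hv u hu
    have hself := h' u hu
    rcases hlam u hu with hl | hl | hl | hl | hl | hl <;>
      simp +decide only [hl] at hcorr hself ⊢ <;>
      clear hlam h h' hl <;> grind
  · intro h
    refine ⟨fun u hu v hv => ?_, fun u hu => ?_⟩
    · have hcorr := h v hv
      rcases hlam v hv with hl | hl | hl | hl | hl | hl <;>
        simp +decide only [hl] at hcorr ⊢ <;>
        clear hlam h hl <;> grind
    · have hself := h u hu
      rcases hlam u hu with hl | hl | hl | hl | hl | hl <;>
        simp +decide only [hl] at hself ⊢ <;>
        clear hlam h hl <;> grind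
end

section
/- Let G be a finite simple undirected bipartite graph, I,O ⊆ V(G), and λ : Oᶜ → {{X},{Z},{X,Z}}. If the open graph (G,I,O,λ) has a Pauli flow, then there exists a map p : Oᶜ → 2^{Iᶜ} such that for every u ∈ Oᶜ: Odd(p(u)) ∖ (O ∪ λ⁻¹({Z})) = {u} ∖ λ⁻¹({Z}) and p(u) ∖ (O ∪ λ⁻¹({X})) = {u} ∖ λ⁻¹({X}). -/
open Finset
open scoped symmDiff

variable {V : Type*} [Fintype V] [DecidableEq V]

/-- `(p, lt)` is a Pauli flow of the open graph `(G, I, O, lam)`: `lt` is a strict partial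
order on `Oᶜ`, `p : Oᶜ → 2^{Iᶜ}`, and the conditions (cX), (cY), (cZ) hold for every
`u ∈ Oᶜ` (where `v ≥ u` means `¬ (v < u)`). -/
def IsPauliFlow (G : SimpleGraph V) [DecidableRel G.Adj] (I O : Finset V)
    (lam : V → Finset Pauli) (p : V → Finset V) (lt : V → V → Prop) : Prop :=
  IsIrrefl V lt ∧ IsTrans V lt ∧
  (∀ u, u ∉ O → Disjoint (p u) I) ∧
  ∀ u, u ∉ O →
    ((Pauli.X ∈ lam u → u ∈ G.oddNbhd (p u) ∧
        ∀ v, v ∉ O → v ≠ u → ¬ lt v u → u ∉ G.oddNbhd (p v)) ∧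
     (Pauli.Y ∈ lam u → u ∈ G.coddNbhd (p u) ∧
        ∀ v, v ∉ O → v ≠ u → ¬ lt v u → u ∉ G.coddNbhd (p v)) ∧
     (Pauli.Z ∈ lam u → u ∈ p u ∧
        ∀ v, v ∉ O → v ≠ u → ¬ lt v u → u ∉ p v))

namespace SimpleGraph

/-- The adjacency matrix over `ZMod 2` sends the indicator of `A` to that of `Odd(A)`. -/
theorem adjMatrix_mulVec_indicator (G : SimpleGraph V) [DecidableRel G.Adj] (A : Finset V)
    (w : V) :
    ∑ v, G.adjMatrix (ZMod 2) w v * (if v ∈ A then 1 else 0) =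
      if w ∈ G.oddNbhd A then 1 else 0 := by
  induction A using Finset.induction_on with
  | empty => simp [oddNbhd]
  | insert a A ha ih =>
    have hsplit : ∀ v, G.adjMatrix (ZMod 2) w v * (if v ∈ insert a A then 1 else 0) =
        (if v = a then G.adjMatrix (ZMod 2) w a else 0) +
          G.adjMatrix (ZMod 2) w v * (if v ∈ A then 1 else 0) := by
      intro v
      by_cases hv : v = a
      · subst hv; simp [ha]
      · simp [hv]
    have hodd : G.oddNbhd (insert a A) = G.neighborFinset a ∆ G.oddNbhd A := by
      simp [oddNbhd, Finset.fold_insert ha]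
    rw [Finset.sum_congr rfl fun v _ => hsplit v, Finset.sum_add_distrib, ih, hodd]
    have h11 : (1 : ZMod 2) + 1 = 0 := by decide
    by_cases h1 : G.Adj a w <;> by_cases h2 : w ∈ G.oddNbhd A <;>
      simp [adjMatrix_apply, Finset.mem_symmDiff, h1, h2, G.adj_comm w a, h11]

omit [DecidableEq V] in
/-- In a 2-coloured graph, the part of a vector on one colour class only contributes to the
odd neighbourhood on the other class. -/
theorem adjMatrix_mulVec_colorClass {R : Type*} [NonAssocSemiring R] (G : SimpleGraph V)
    [DecidableRel G.Adj] (C : G.Coloring (Fin 2)) (k : Fin 2) (x : V → R) (w : V) :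
    ∑ v, G.adjMatrix R w v * (if C v = k then x v else 0) =
      if C w = k then 0 else ∑ v, G.adjMatrix R w v * x v := by
  have hne : ∀ v, G.Adj w v → C w ≠ C v := fun v h => C.valid h
  split_ifs with hw
  · refine Finset.sum_eq_zero fun v _ => ?_
    by_cases h : G.Adj w v
    · have := hne v h
      rw [if_neg (by grind), mul_zero]
    · simp [h]
  · refine Finset.sum_congr rfl fun v _ => ?_
    by_cases h : G.Adj w v
    · have := hne v h
      rw [if_pos (by omega)]
    · simp [h]

end SimpleGraph

/-- The submodule of functions vanishing on `S`. -/
def Submodule.vanishingOn {α : Type*} (R : Type*) [Semiring R] (S : Finset α) :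
    Submodule R (α → R) where
  carrier := {x | ∀ v ∈ S, x v = 0}
  add_mem' hx hy v hv := by simp [hx v hv, hy v hv]
  zero_mem' _ _ := rfl
  smul_mem' a x hx v hv := by simp [hx v hv]

/-- A submodule of a finite function space containing, for every index `i`, a vector that is `1`
at `i` and otherwise supported strictly above `i`, is the whole space. -/
theorem Submodule.eq_top_of_unitriangular {ι R : Type*} [Fintype ι] [DecidableEq ι] [Ring R]
    (N : Submodule R (ι → R)) (lt : ι → ι → Prop) (hwf : WellFounded (flip lt))
    (h : ∀ i, ∃ r ∈ N, r i = 1 ∧ ∀ j, j ≠ i → ¬ lt i j → r j = 0) : N = ⊤ := by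
  have hexpand : ∀ r : ι → R, ∑ j, r j • (Pi.single j 1 : ι → R) = r := by
    intro r
    ext k
    simp [Finset.sum_apply, Pi.single_apply]
  have hsingle : ∀ i, (Pi.single i 1 : ι → R) ∈ N := by
    intro i
    induction i using hwf.induction with
    | _ i ih =>
      obtain ⟨r, hr, hri, hr0⟩ := h i
      have hsum : Pi.single i 1 + ∑ j ∈ univ.erase i, r j • (Pi.single j 1 : ι → R) = r := by
        conv_rhs => rw [← hexpand r, ← Finset.add_sum_erase _ _ (mem_univ i), hri, one_smul]
      rw [eq_sub_of_add_eq hsum]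
      refine N.sub_mem hr (N.sum_mem fun j hj => ?_)
      by_cases hij : lt i j
      · exact N.smul_mem _ (ih j hij)
      · rw [hr0 j (ne_of_mem_erase hj) hij, zero_smul]
        exact N.zero_mem
  refine eq_top_iff.2 fun r _ => ?_
  rw [← hexpand r]
  exact N.sum_mem fun j _ => N.smul_mem _ (hsingle j)

/-- The constraints of an open graph with real Pauli labels: `(w, true)` for `X ∈ λ_w` and
`(w, false)` for `Z ∈ λ_w`, with `w` a non-output. -/
abbrev RealConstraint (O : Finset V) (lam : V → Finset Pauli) : Type _ :=
  {c : V × Bool // c.1 ∉ O ∧ (if c.2 then Pauli.X else Pauli.Z) ∈ lam c.1}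

/-- Evaluates the constraints: the odd neighbourhood at `(w, true)`, the vector itself at
`(w, false)`. -/
def realConstraintMap (G : SimpleGraph V) [DecidableRel G.Adj] (O : Finset V)
    (lam : V → Finset Pauli) : (V → ZMod 2) →ₗ[ZMod 2] (RealConstraint O lam → ZMod 2) where
  toFun x c := if c.1.2 then ∑ v, G.adjMatrix (ZMod 2) c.1.1 v * x v else x c.1.1
  map_add' x y := by
    ext c
    by_cases h : c.1.2 <;> simp [h, mul_add, Finset.sum_add_distrib]
  map_smul' a x := by
    ext c
    by_cases h : c.1.2 <;> simp [h, Finset.mul_sum, mul_left_comm]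

/-- For a bipartite graph with Pauli flow, every assignment of values to the constraints is
attained by a vector vanishing on the inputs. -/
theorem IsPauliFlow.map_realConstraintMap_eq_top {G : SimpleGraph V} [DecidableRel G.Adj]
    {I O : Finset V} {lam : V → Finset Pauli} {p : V → Finset V} {lt : V → V → Prop}
    (hflow : IsPauliFlow G I O lam p lt) (hbip : G.Colorable 2) :
    (Submodule.vanishingOn (ZMod 2) I).map (realConstraintMap G O lam) = ⊤ := by
  obtain ⟨C⟩ := hbip
  obtain ⟨hirr, htrans, hI, hp⟩ := hflow
  have hwf : WellFounded (flip lt) :=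
    haveI : Std.Irrefl (flip lt) := ⟨fun a => hirr.irrefl a⟩
    haveI : IsTrans V (flip lt) := ⟨fun a b c hab hbc => htrans.trans _ _ _ hbc hab⟩
    Finite.wellFounded_of_trans_of_irrefl _
  refine Submodule.eq_top_of_unitriangular _ (fun i j => lt i.1.1 j.1.1)
    (InvImage.wf (fun i : RealConstraint O lam => i.1.1) hwf) ?_
  rintro ⟨⟨u, b⟩, hu, hb⟩
  have key : ∀ k : Fin 2, ∃ x ∈ Submodule.vanishingOn (ZMod 2) I, ∀ j : RealConstraint O lam,
      realConstraintMap G O lam x j =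
        if j.1.2 then (if C j.1.1 = k then 0 else if j.1.1 ∈ G.oddNbhd (p u) then 1 else 0)
        else (if C j.1.1 = k then if j.1.1 ∈ p u then 1 else 0 else 0) := by
    intro k
    refine ⟨fun v => if C v = k then if v ∈ p u then 1 else 0 else 0, ?_, fun j => ?_⟩
    · intro v hv
      have : v ∉ p u := fun h => Finset.disjoint_left.1 (hI u hu) h hv
      simp [this]
    · simp only [realConstraintMap, LinearMap.coe_mk, AddHom.coe_mk]
      rw [G.adjMatrix_mulVec_colorClass C k fun v => if v ∈ p u then 1 else 0,
        G.adjMatrix_mulVec_indicator]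
  obtain ⟨x, hx, hxe⟩ := key (if b then C u + 1 else C u)
  have hC : C u ≠ C u + 1 := by omega
  refine ⟨_, Submodule.mem_map_of_mem hx, ?_, ?_⟩
  · rw [hxe]
    cases b
    · have := ((hp u hu).2.2 (by simpa using hb)).1
      simp [this]
    · have := ((hp u hu).1 (by simpa using hb)).1
      simp [this, hC]
  · rintro ⟨⟨w, d⟩, hw, hd⟩ hne hlt
    rw [hxe]
    by_cases hwu : w = u
    · subst hwu
      cases b <;> cases d <;> simp_all
    · cases d
      · have := ((hp w hw).2.2 (by simpa using hd)).2 u hu (Ne.symm hwu) hlt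
        simp [this]
      · have := ((hp w hw).1 (by simpa using hd)).2 u hu (Ne.symm hwu) hlt
        simp [this]

/-- If a bipartite open graph with real Pauli measurements (`λ_u ∈ {{X},{Z},{X,Z}}`) has a
Pauli flow, then there is a map `p : Oᶜ → 2^{Iᶜ}` in super-normal form:
`Odd(p(u)) ∖ (O ∪ λ⁻¹({Z})) = {u} ∖ λ⁻¹({Z})` and
`p(u) ∖ (O ∪ λ⁻¹({X})) = {u} ∖ λ⁻¹({X})` for every `u ∈ Oᶜ`. -/
theorem bipartite_real_pauliFlow_normal_form (G : SimpleGraph V) [DecidableRel G.Adj]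
    (I O : Finset V) (lam : V → Finset Pauli)
    (hbip : G.Colorable 2)
    (hreal : ∀ u, u ∉ O →
      lam u = {Pauli.X} ∨ lam u = {Pauli.Z} ∨ lam u = {Pauli.X, Pauli.Z})
    (hflow : ∃ (p : V → Finset V) (lt : V → V → Prop), IsPauliFlow G I O lam p lt) :
    ∃ p : V → Finset V, (∀ u, u ∉ O → Disjoint (p u) I) ∧
      ∀ u, u ∉ O →
        G.oddNbhd (p u) \ (O ∪ univ.filter fun w => w ∉ O ∧ lam w = {Pauli.Z}) =
          {u} \ univ.filter (fun w => w ∉ O ∧ lam w = {Pauli.Z}) ∧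
        p u \ (O ∪ univ.filter fun w => w ∉ O ∧ lam w = {Pauli.X}) =
          {u} \ univ.filter (fun w => w ∉ O ∧ lam w = {Pauli.X}) := by
  classical
  obtain ⟨p, lt, hpf⟩ := hflow
  have htop := hpf.map_realConstraintMap_eq_top hbip
  have hsolve : ∀ u, ∃ A : Finset V, Disjoint A I ∧
      ∀ w, w ∉ O → (Pauli.X ∈ lam w → (w ∈ G.oddNbhd A ↔ w = u)) ∧
        (Pauli.Z ∈ lam w → (w ∈ A ↔ w = u)) := by
    intro u
    obtain ⟨x, hx, hxe⟩ := Submodule.mem_map.1 (htop.ge (Submodule.mem_top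
      (x := fun c : RealConstraint O lam => if c.1.1 = u then 1 else 0)))
    have hind : ∀ v, (if v ∈ univ.filter (fun v => x v = 1) then 1 else 0) = x v := by
      intro v
      have : ∀ a : ZMod 2, (if a = 1 then 1 else 0) = a := by decide
      simpa using this (x v)
    refine ⟨univ.filter fun v => x v = 1, ?_, fun w hw => ⟨fun hX => ?_, fun hZ => ?_⟩⟩
    · refine Finset.disjoint_left.2 fun v hv hvI => ?_
      have h0 : x v = 0 := by simpa using hx v hvI
      simp [h0] at hv
    · have h := congrFun hxe ⟨(w, true), hw, by simpa using hX⟩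
      have hodd := G.adjMatrix_mulVec_indicator (univ.filter fun v => x v = 1) w
      simp only [hind] at hodd
      simp only [realConstraintMap, LinearMap.coe_mk, AddHom.coe_mk, if_true, hodd] at h
      split_ifs at h <;> simp_all
    · have h := congrFun hxe ⟨(w, false), hw, by simpa using hZ⟩
      simp only [realConstraintMap, LinearMap.coe_mk, AddHom.coe_mk, Bool.false_eq_true,
        if_false] at h
      by_cases hwu : w = u <;> simp_all
  choose q hqI hq using hsolve
  refine ⟨q, fun u _ => hqI u, fun u hu => ⟨?_, ?_⟩⟩
  · ext w
    by_cases hw : w ∈ O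
    · have : w ≠ u := by rintro rfl; exact hu hw
      simp [hw, this]
    · have := (hq u w hw).1
      rcases hreal w hw with h | h | h <;> simp_all
  · ext w
    by_cases hw : w ∈ O
    · have : w ≠ u := by rintro rfl; exact hu hw
      simp [hw, this]
    · have := (hq u w hw).2
      rcases hreal w hw with h | h | h <;> simp_all
end

section
/- Let (G,I,O,λ) be an open graph with λ : Oᶜ → {{X},{Z},{X,Z}}, and let (p,<) be a Pauli flow of (G,I,O,λ). If u ∈ Oᶜ is maximal for <, i.e. there is no v with u < v, then Odd(p(u)) ∖ (O ∪ λ⁻¹({Z})) = {u} ∖ λ⁻¹({Z}) and p(u) ∖ (O ∪ λ⁻¹({X})) = {u} ∖ λ⁻¹({X}). -/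
open Finset
open scoped symmDiff

variable {V : Type*} [Fintype V] [DecidableEq V]

/-- If `(p,<)` is a Pauli flow of an open graph with real Pauli measurements
(`λ_u ∈ {{X},{Z},{X,Z}}`) and `u ∈ Oᶜ` is maximal for `<`, then
`Odd(p(u)) ∖ (O ∪ λ⁻¹({Z})) = {u} ∖ λ⁻¹({Z})` and `p(u) ∖ (O ∪ λ⁻¹({X})) = {u} ∖ λ⁻¹({X})`. -/
theorem pauliFlow_maximal_normal_form (G : SimpleGraph V) [DecidableRel G.Adj]
    (I O : Finset V) (lam : V → Finset Pauli)
    (hreal : ∀ u, u ∉ O →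
      lam u = {Pauli.X} ∨ lam u = {Pauli.Z} ∨ lam u = {Pauli.X, Pauli.Z})
    (p : V → Finset V) (lt : V → V → Prop)
    (hflow : IsPauliFlow G I O lam p lt)
    (u : V) (hu : u ∉ O) (hmax : ∀ v, v ∉ O → ¬ lt u v) :
    G.oddNbhd (p u) \ (O ∪ univ.filter fun w => w ∉ O ∧ lam w = {Pauli.Z}) =
      {u} \ univ.filter (fun w => w ∉ O ∧ lam w = {Pauli.Z}) ∧
    p u \ (O ∪ univ.filter fun w => w ∉ O ∧ lam w = {Pauli.X}) =
      {u} \ univ.filter (fun w => w ∉ O ∧ lam w = {Pauli.X}) := by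
  obtain ⟨-, -, -, hcond⟩ := hflow
  have hX : ∀ w, w ∉ O → lam w ≠ {Pauli.Z} → Pauli.X ∈ lam w := fun w hw hne => by
    rcases hreal w hw with h | h | h <;> simp_all
  have hZ : ∀ w, w ∉ O → lam w ≠ {Pauli.X} → Pauli.Z ∈ lam w := fun w hw hne => by
    rcases hreal w hw with h | h | h <;> simp_all
  constructor
  · ext w
    simp only [mem_sdiff, mem_union, mem_filter, mem_univ, true_and, mem_singleton, not_or,
      not_and]
    constructor
    · rintro ⟨hmem, hw, hne⟩
      refine ⟨?_, hne⟩
      by_contra hwu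
      exact ((hcond w hw).1 (hX w hw (hne hw))).2 u hu (Ne.symm hwu) (hmax w hw) hmem
    · rintro ⟨rfl, hne⟩
      exact ⟨((hcond w hu).1 (hX w hu (hne hu))).1, hu, hne⟩
  · ext w
    simp only [mem_sdiff, mem_union, mem_filter, mem_univ, true_and, mem_singleton, not_or,
      not_and]
    constructor
    · rintro ⟨hmem, hw, hne⟩
      refine ⟨?_, hne⟩
      by_contra hwu
      exact ((hcond w hw).2.2 (hZ w hw (hne hw))).2 u hu (Ne.symm hwu) (hmax w hw) hmem
    · rintro ⟨rfl, hne⟩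
      exact ⟨((hcond w hu).2.2 (hZ w hu (hne hu))).1, hu, hne⟩
end
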